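/- Let x, y ∈ M_n(ℂ) be positive semidefinite and let |||·||| be any unitarily invariant norm on M_n(ℂ). Then |||y^{1/4} x^{1/2} y^{1/4} + x^{1/4} y^{1/2} x^{1/4}||| ≤ |||x + y|||. -/

import Mathlib

open scoped Matrix ComplexOrder

/-- The real power `A^s` of a positive semidefinite matrix, defined via the spectral
decomposition (equivalently, the continuous functional calculus), with the convention
`A^0 = 1`.  (If `A` is not Hermitian we return the junk value `0`.) -/
noncomputable def psdPow {N : ℕ} (A : Matrix (Fin N) (Fin N) ℂ) (s : ℝ) :
    Matrix (Fin N) (Fin N) ℂ :=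
  if hA : A.IsHermitian then
    (Matrix.IsHermitian.eigenvectorUnitary hA : Matrix (Fin N) (Fin N) ℂ) *
      Matrix.diagonal (fun i => ((hA.eigenvalues i ^ s : ℝ) : ℂ)) *
      (Matrix.IsHermitian.eigenvectorUnitary hA : Matrix (Fin N) (Fin N) ℂ)ᴴ
  else 0

namespace UnitarilyInvariant

/-- A seminorm on complex matrices that is invariant under unitary multiplication. -/
structure IsUISeminorm {n : ℕ} (N : Matrix (Fin n) (Fin n) ℂ → ℝ) : Prop where
  add_le : ∀ A B, N (A + B) ≤ N A + N B
  smul_eq : ∀ (c : ℂ) A, N (c • A) = ‖c‖ * N A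
  unitary_eq : ∀ (A U V : Matrix (Fin n) (Fin n) ℂ),
    U ∈ Matrix.unitaryGroup (Fin n) ℂ → V ∈ Matrix.unitaryGroup (Fin n) ℂ → N (U * A * V) = N A

variable {n : ℕ}

section Factorization

open scoped MatrixOrder Matrix.Norms.L2Operator

theorem exists_posSemidef_sq_eq {A : Matrix (Fin n) (Fin n) ℂ} (hA : A.PosSemidef) :
    ∃ B : Matrix (Fin n) (Fin n) ℂ, B.PosSemidef ∧ B * B = A :=
  ⟨CFC.sqrt A, Matrix.nonneg_iff_posSemidef.mp (CFC.sqrt_nonneg A),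
    CFC.sqrt_mul_sqrt_self A hA.nonneg⟩

theorem exists_posDef_sq_eq {A : Matrix (Fin n) (Fin n) ℂ} (hA : A.PosDef) :
    ∃ B : Matrix (Fin n) (Fin n) ℂ, B.PosDef ∧ B * B = A := by
  obtain ⟨B, hB, rfl⟩ := exists_posSemidef_sq_eq hA.posSemidef
  exact ⟨B, hB.posDef_iff_isUnit.mpr (isUnit_of_mul_isUnit_left hA.isUnit), rfl⟩

theorem posDef_mul_self {X : Matrix (Fin n) (Fin n) ℂ} (hX : X.PosDef) : (X * X).PosDef := by
  have := Matrix.PosDef.conjTranspose_mul_self X (Matrix.mulVec_injective_of_isUnit hX.isUnit)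
  rwa [hX.isHermitian.eq] at this

/-- Polar decomposition of an invertible matrix. -/
theorem exists_polar {X : Matrix (Fin n) (Fin n) ℂ} (hX : IsUnit X) :
    ∃ U ∈ Matrix.unitaryGroup (Fin n) ℂ, ∃ H : Matrix (Fin n) (Fin n) ℂ,
      H.PosDef ∧ X = U * H ∧ H * H = Xᴴ * X := by
  have hpos : (Xᴴ * X).PosDef := Matrix.PosDef.conjTranspose_mul_self X
    (Matrix.mulVec_injective_of_isUnit hX)
  obtain ⟨H, hH, hHH⟩ := exists_posDef_sq_eq hpos
  have hdet : IsUnit H.det := (Matrix.isUnit_iff_isUnit_det _).mp hH.isUnit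
  refine ⟨X * H⁻¹, ?_, H, hH, ?_, hHH⟩
  · rw [Matrix.mem_unitaryGroup_iff', Matrix.star_eq_conjTranspose, Matrix.conjTranspose_mul,
      Matrix.conjTranspose_nonsing_inv, hH.isHermitian.eq]
    calc H⁻¹ * Xᴴ * (X * H⁻¹) = H⁻¹ * (Xᴴ * X) * H⁻¹ := by simp only [Matrix.mul_assoc]
      _ = 1 := by
        rw [← hHH, ← Matrix.mul_assoc, Matrix.nonsing_inv_mul _ hdet, Matrix.one_mul,
          Matrix.mul_nonsing_inv _ hdet]
  · rw [Matrix.mul_assoc, Matrix.nonsing_inv_mul _ hdet, Matrix.mul_one]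

theorem exists_eq_mul_mul_conjTranspose {P Q : Matrix (Fin n) (Fin n) ℂ} (hP : P.PosDef)
    (hQ : Q.PosDef) (hPQ : (Q - P).PosSemidef) :
    ∃ C : Matrix (Fin n) (Fin n) ℂ, IsUnit C ∧ (1 - Cᴴ * C).PosSemidef ∧ P = C * Q * Cᴴ := by
  obtain ⟨p, hp, rfl⟩ := exists_posDef_sq_eq hP
  obtain ⟨r, hr, rfl⟩ := exists_posDef_sq_eq hQ
  have hdet : IsUnit r.det := (Matrix.isUnit_iff_isUnit_det _).mp hr.isUnit
  have h1 : r⁻¹ * r = 1 := Matrix.nonsing_inv_mul _ hdet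
  have h2 : r * r⁻¹ = 1 := Matrix.mul_nonsing_inv _ hdet
  have hadj : (p * r⁻¹)ᴴ = r⁻¹ * p := by
    rw [Matrix.conjTranspose_mul, hr.inv.isHermitian.eq, hp.isHermitian.eq]
  refine ⟨p * r⁻¹, hp.isUnit.mul hr.inv.isUnit, ?_, ?_⟩ <;> rw [hadj]
  · have h := hPQ.mul_mul_conjTranspose_same r⁻¹
    rw [hr.inv.isHermitian.eq] at h
    convert h using 1
    calc 1 - r⁻¹ * p * (p * r⁻¹) = (r⁻¹ * r) * (r * r⁻¹) - r⁻¹ * p * (p * r⁻¹) := by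
          rw [h1, h2, one_mul]
      _ = r⁻¹ * (r * r - p * p) * r⁻¹ := by noncomm_ring
  · calc p * p = p * (r⁻¹ * r) * (r * r⁻¹) * p := by rw [h1, h2, mul_one, mul_one]
      _ = p * r⁻¹ * (r * r) * (r⁻¹ * p) := by noncomm_ring

/-- A Hermitian contraction is the average of a unitary and its adjoint. -/
theorem exists_unitary_add_star {H : Matrix (Fin n) (Fin n) ℂ} (hH : H.IsHermitian)
    (h1 : (1 - H * H).PosSemidef) :
    ∃ W ∈ Matrix.unitaryGroup (Fin n) ℂ, H = (1 / 2 : ℂ) • (W + star W) := by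
  have hsa : IsSelfAdjoint H := hH
  have hnorm : ‖H‖ ≤ 1 := by
    have h0 : (0 : Matrix (Fin n) (Fin n) ℂ) ≤ H * H := by
      have := Matrix.posSemidef_conjTranspose_mul_self H
      rw [hH.eq] at this
      exact this.nonneg
    have h2 : ‖H * H‖ ≤ 1 :=
      (CStarAlgebra.norm_le_one_iff_of_nonneg _ h0).mpr (Matrix.le_iff.mpr h1)
    have h3 : ‖H * H‖ = ‖H‖ * ‖H‖ := by
      have := CStarRing.norm_star_mul_self (x := H)
      rwa [hsa.star_eq] at this
    nlinarith [norm_nonneg H]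
  let W := selfAdjoint.unitarySelfAddISMul (⟨H, hsa⟩ : selfAdjoint _) hnorm
  refine ⟨W, W.2, ?_⟩
  have := selfAdjoint.realPart_unitarySelfAddISMul (⟨H, hsa⟩ : selfAdjoint _) hnorm
  have := congrArg (fun z : selfAdjoint (Matrix (Fin n) (Fin n) ℂ) =>
    (z : Matrix (Fin n) (Fin n) ℂ)) this
  simp only [realPart_apply_coe] at this
  rw [← this]
  ext i j
  simp [W, mul_add]

end Factorization

namespace IsUISeminorm

variable {N : Matrix (Fin n) (Fin n) ℂ → ℝ}

theorem unitary_mul (hN : IsUISeminorm N) {U : Matrix (Fin n) (Fin n) ℂ}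
    (hU : U ∈ Matrix.unitaryGroup (Fin n) ℂ) (A : Matrix (Fin n) (Fin n) ℂ) :
    N (U * A) = N A := by
  simpa using hN.unitary_eq A U 1 hU (one_mem _)

theorem mul_unitary (hN : IsUISeminorm N) {U : Matrix (Fin n) (Fin n) ℂ}
    (hU : U ∈ Matrix.unitaryGroup (Fin n) ℂ) (A : Matrix (Fin n) (Fin n) ℂ) :
    N (A * U) = N A := by
  simpa using hN.unitary_eq A 1 U (one_mem _) hU

theorem half_smul_add_le (hN : IsUISeminorm N) (A B : Matrix (Fin n) (Fin n) ℂ) :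
    N ((1 / 2 : ℂ) • (A + B)) ≤ 1 / 2 * (N A + N B) := by
  rw [hN.smul_eq]
  have := hN.add_le A B
  norm_num
  linarith

theorem contraction_mul_le (hN : IsUISeminorm N) {C : Matrix (Fin n) (Fin n) ℂ} (hC : IsUnit C)
    (h1 : (1 - Cᴴ * C).PosSemidef) (A : Matrix (Fin n) (Fin n) ℂ) : N (C * A) ≤ N A := by
  obtain ⟨U, hU, H, hH, rfl, hHH⟩ := exists_polar hC
  rw [← hHH] at h1
  obtain ⟨W, hW, hHW⟩ := exists_unitary_add_star hH.isHermitian h1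
  rw [Matrix.mul_assoc, hN.unitary_mul hU, hHW, smul_mul_assoc, add_mul]
  refine (hN.half_smul_add_le _ _).trans_eq ?_
  rw [hN.unitary_mul hW, hN.unitary_mul (Unitary.star_mem hW)]
  ring

theorem mul_conjTranspose_contraction_le (hN : IsUISeminorm N) {C : Matrix (Fin n) (Fin n) ℂ}
    (hC : IsUnit C) (h1 : (1 - Cᴴ * C).PosSemidef) (A : Matrix (Fin n) (Fin n) ℂ) :
    N (A * Cᴴ) ≤ N A := by
  obtain ⟨U, hU, H, hH, rfl, hHH⟩ := exists_polar hC
  rw [← hHH] at h1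
  obtain ⟨W, hW, hHW⟩ := exists_unitary_add_star hH.isHermitian h1
  rw [Matrix.conjTranspose_mul, hH.isHermitian.eq, ← Matrix.mul_assoc,
    ← Matrix.star_eq_conjTranspose, hN.mul_unitary (Unitary.star_mem hU), hHW, mul_smul_comm,
    mul_add]
  refine (hN.half_smul_add_le _ _).trans_eq ?_
  rw [hN.mul_unitary hW, hN.mul_unitary (Unitary.star_mem hW)]
  ring

theorem mono (hN : IsUISeminorm N) {P Q : Matrix (Fin n) (Fin n) ℂ} (hP : P.PosDef)
    (hQ : Q.PosDef) (hPQ : (Q - P).PosSemidef) : N P ≤ N Q := by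
  obtain ⟨C, hC, h1, rfl⟩ := exists_eq_mul_mul_conjTranspose hP hQ hPQ
  exact (hN.mul_conjTranspose_contraction_le hC h1 _).trans (hN.contraction_mul_le hC h1 _)

/-- Although squaring is not operator monotone, it is monotone after taking norms. -/
theorem sq_mono (hN : IsUISeminorm N) {P Q : Matrix (Fin n) (Fin n) ℂ} (hP : P.PosDef)
    (hQ : Q.PosDef) (hPQ : (Q - P).PosSemidef) : N (P * P) ≤ N (Q * Q) := by
  obtain ⟨C, hC, h1, rfl⟩ := exists_eq_mul_mul_conjTranspose hP hQ hPQ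
  have hCQ : (Q * Cᴴ * (C * Q)).PosDef := by
    have := Matrix.PosDef.conjTranspose_mul_self (C * Q)
      (Matrix.mulVec_injective_of_isUnit (hC.mul hQ.isUnit))
    rwa [Matrix.conjTranspose_mul, hQ.isHermitian.eq] at this
  calc N (C * Q * Cᴴ * (C * Q * Cᴴ)) = N (C * (Q * Cᴴ * (C * Q)) * Cᴴ) := by
        congr 1; noncomm_ring
    _ ≤ N (C * (Q * Cᴴ * (C * Q))) := hN.mul_conjTranspose_contraction_le hC h1 _
    _ ≤ N (Q * Cᴴ * (C * Q)) := hN.contraction_mul_le hC h1 _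
    _ ≤ N (Q * Q) := by
      refine hN.mono hCQ (posDef_mul_self hQ) ?_
      have h := h1.mul_mul_conjTranspose_same Q
      rw [hQ.isHermitian.eq] at h
      convert h using 1
      noncomm_ring

/-- Obtained from the arithmetic-geometric mean inequality `4 |ab| ≤ Vᴴ (2 (a² + b²)) V` with a
unitary `V`, by squaring inside the norm. -/
theorem mul_sq_mul_le_of_posDef (hN : IsUISeminorm N) {a b : Matrix (Fin n) (Fin n) ℂ}
    (ha : a.PosDef) (hb : b.PosDef) :
    2 * N (b * (a * a) * b) ≤ N (a * a * (a * a) + b * b * (b * b)) := by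
  have hae : aᴴ = a := ha.isHermitian.eq
  have hbe : bᴴ = b := hb.isHermitian.eq
  obtain ⟨u, hu, g, hg, hab, hgg⟩ := exists_polar (ha.isUnit.mul hb.isUnit)
  have hge : gᴴ = g := hg.isHermitian.eq
  rw [Matrix.conjTranspose_mul, hae, hbe] at hgg
  have hu1 : uᴴ * u = 1 := Matrix.mem_unitaryGroup_iff'.mp hu
  have hu2 : u * uᴴ = 1 := Matrix.mem_unitaryGroup_iff.mp hu
  have huab : uᴴ * (a * b) = g := by rw [hab, ← mul_assoc, hu1, one_mul]
  have hbau : b * a * u = g := by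
    have := congrArg Matrix.conjTranspose huab
    simpa [Matrix.conjTranspose_mul, hae, hbe, hge] using this
  have h4g : ((4 : ℂ) • g).PosDef := hg.smul (by norm_num)
  set Z := a * u + b with hZ
  have hZa : Zᴴ = uᴴ * a + b := by simp [hZ, Matrix.conjTranspose_mul, hae, hbe]
  have hda : (a * u - b)ᴴ = uᴴ * a - b := by simp [Matrix.conjTranspose_mul, hae, hbe]
  have hle : (Zᴴ * Z - (4 : ℂ) • g).PosSemidef := by
    have h := Matrix.posSemidef_conjTranspose_mul_self (a * u - b)
    rw [hda] at h
    convert h using 1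
    have h4 : (4 : ℂ) • g = 2 * (uᴴ * (a * b)) + 2 * (b * a * u) := by
      rw [huab, hbau, ← add_mul, ofNat_smul_eq_nsmul ℂ 4 g]
      noncomm_ring
    rw [h4, hZa, hZ]
    noncomm_ring
  have hZZ : (Zᴴ * Z).PosDef := by
    have := h4g.add_posSemidef hle
    rwa [add_sub_cancel] at this
  have hZu : IsUnit Z := isUnit_of_mul_isUnit_right hZZ.isUnit
  obtain ⟨V, hV, H, hH, hZV, hHH⟩ := exists_polar hZu
  have hV1 : Vᴴ * V = 1 := Matrix.mem_unitaryGroup_iff'.mp hV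
  have hV2 : V * Vᴴ = 1 := Matrix.mem_unitaryGroup_iff.mp hV
  have hVZ : Vᴴ * (Z * Zᴴ) * V = Zᴴ * Z := by
    rw [← hHH, hZV, Matrix.conjTranspose_mul, hH.isHermitian.eq]
    calc Vᴴ * (V * H * (H * Vᴴ)) * V = (Vᴴ * V) * (H * H) * (Vᴴ * V) := by noncomm_ring
      _ = H * H := by rw [hV1, one_mul, mul_one]
  set S := a * a + b * b with hS
  have hSpos : S.PosDef := (posDef_mul_self ha).add (posDef_mul_self hb)
  have h2S : ((2 : ℂ) • S).PosDef := hSpos.smul (by norm_num)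
  have hle2 : ((2 : ℂ) • S - Z * Zᴴ).PosSemidef := by
    have h := Matrix.posSemidef_self_mul_conjTranspose (a * u - b)
    rw [hda] at h
    convert h using 1
    rw [hZa, hZ, hS, two_smul]
    have e1 : (a * u + b) * (uᴴ * a + b) = a * (u * uᴴ) * a + a * u * b + b * uᴴ * a + b * b := by
      noncomm_ring
    have e2 : (a * u - b) * (uᴴ * a - b) = a * (u * uᴴ) * a - a * u * b - b * uᴴ * a + b * b := by
      noncomm_ring
    rw [e1, e2, hu2]
    noncomm_ring
  have hQ : (Vᴴ * ((2 : ℂ) • S) * V).PosDef :=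
    h2S.conjTranspose_mul_mul_same (Matrix.mulVec_injective_of_isUnit
      (IsUnit.of_mul_eq_one_right _ hV1))
  have hgQ : (Vᴴ * ((2 : ℂ) • S) * V - (4 : ℂ) • g).PosSemidef := by
    have h := (hle2.conjTranspose_mul_mul_same V).add hle
    rw [mul_sub, sub_mul, hVZ, sub_add_sub_cancel] at h
    exact h
  have hSS : (2 * (a * a * (a * a) + b * b * (b * b)) - S * S).PosSemidef := by
    have h := Matrix.posSemidef_conjTranspose_mul_self (a * a - b * b)
    simp only [Matrix.conjTranspose_sub, Matrix.conjTranspose_mul, hae, hbe] at h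
    convert h using 1
    rw [hS]
    noncomm_ring
  have hT : (a * a * (a * a) + b * b * (b * b)).PosDef := (posDef_mul_self (posDef_mul_self ha)).add (posDef_mul_self (posDef_mul_self hb))
  have key1 := hN.sq_mono h4g hQ hgQ
  have key2 : N (S * S) ≤ 2 * N (a * a * (a * a) + b * b * (b * b)) := by
    have h2T : ((2 : ℂ) • (a * a * (a * a) + b * b * (b * b))).PosDef := hT.smul (by norm_num)
    have e : (2 : ℂ) • (a * a * (a * a) + b * b * (b * b)) =
        2 * (a * a * (a * a) + b * b * (b * b)) := by rw [two_smul, two_mul]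
    have := hN.mono (posDef_mul_self hSpos) h2T (by rwa [e])
    rwa [hN.smul_eq, Complex.norm_ofNat] at this
  have e1 : (4 : ℂ) • g * ((4 : ℂ) • g) = (16 : ℂ) • (b * (a * a) * b) := by
    rw [smul_mul_smul_comm, hgg]
    norm_num [mul_assoc]
  have e2 : Vᴴ * ((2 : ℂ) • S) * V * (Vᴴ * ((2 : ℂ) • S) * V) = (4 : ℂ) • (Vᴴ * (S * S) * V) := by
    calc _ = (4 : ℂ) • (Vᴴ * (S * (V * Vᴴ) * S) * V) := by
          simp only [mul_smul_comm, smul_mul_assoc, smul_smul, mul_assoc]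
          norm_num
      _ = _ := by rw [hV2, mul_one]
  rw [e1, e2, hN.smul_eq, hN.smul_eq, Complex.norm_ofNat, Complex.norm_ofNat,
    ← Matrix.star_eq_conjTranspose, hN.unitary_eq _ _ _ (Unitary.star_mem hV) hV] at key1
  linarith

section Continuity

open scoped Matrix.Norms.Elementwise

protected theorem continuous (hN : IsUISeminorm N) : Continuous N := by
  have hconv : ConvexOn ℝ Set.univ N := by
    refine ⟨convex_univ, fun A _ B _ s t hs ht _ => ?_⟩
    have h : ∀ (r : ℝ), 0 ≤ r → ∀ C : Matrix (Fin n) (Fin n) ℂ, N (r • C) = r * N C := by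
      intro r hr C
      rw [← Complex.coe_smul, hN.smul_eq, Complex.norm_real, Real.norm_of_nonneg hr]
    refine (hN.add_le _ _).trans_eq ?_
    rw [h s hs, h t ht, smul_eq_mul, smul_eq_mul]
  exact hconv.locallyLipschitz.continuous

end Continuity

theorem mul_sq_mul_le (hN : IsUISeminorm N) {a b : Matrix (Fin n) (Fin n) ℂ}
    (ha : a.PosSemidef) (hb : b.PosSemidef) :
    2 * N (b * (a * a) * b) ≤ N (a * a * (a * a) + b * b * (b * b)) := by
  let p : Matrix (Fin n) (Fin n) ℂ → ℝ → Matrix (Fin n) (Fin n) ℂ := fun c ε => c + (ε : ℂ) • 1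
  have hp : ∀ c, Continuous (p c) := fun c => by fun_prop
  have hp0 : ∀ c, p c 0 = c := fun c => by simp [p]
  have hpos : ∀ {c : Matrix (Fin n) (Fin n) ℂ}, c.PosSemidef → ∀ ε : ℝ, 0 < ε → (p c ε).PosDef :=
    fun hc ε hε => Matrix.PosDef.posSemidef_add hc (Matrix.PosDef.one.smul (by exact_mod_cast hε))
  have hcN := hN.continuous
  have hf : Continuous fun ε => 2 * N (p b ε * (p a ε * p a ε) * p b ε) := by
    have := hp a; have := hp b; fun_prop
  have hg : Continuous fun ε =>
      N (p a ε * p a ε * (p a ε * p a ε) + p b ε * p b ε * (p b ε * p b ε)) := by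
    have := hp a; have := hp b; fun_prop
  have hcl : (0 : ℝ) ∈ closure (Set.Ioi (0 : ℝ)) := by simp
  have h0 := closure_minimal (fun ε (hε : ε ∈ Set.Ioi (0 : ℝ)) =>
    hN.mul_sq_mul_le_of_posDef (hpos ha ε hε) (hpos hb ε hε)) (isClosed_le hf hg) hcl
  change 2 * N (p b 0 * (p a 0 * p a 0) * p b 0) ≤
    N (p a 0 * p a 0 * (p a 0 * p a 0) + p b 0 * p b 0 * (p b 0 * p b 0)) at h0
  simpa only [hp0] using h0

end IsUISeminorm

section Power

variable {A : Matrix (Fin n) (Fin n) ℂ}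

theorem psdPow_posSemidef (hA : A.PosSemidef) (s : ℝ) : (psdPow A s).PosSemidef := by
  rw [psdPow, dif_pos hA.isHermitian]
  refine (Matrix.PosSemidef.diagonal fun i => ?_).mul_mul_conjTranspose_same _
  exact Complex.zero_le_real.mpr <| Real.rpow_nonneg (hA.eigenvalues_nonneg i) s

theorem psdPow_mul_psdPow (hA : A.PosSemidef) {s t : ℝ} (hst : s + t ≠ 0) :
    psdPow A s * psdPow A t = psdPow A (s + t) := by
  simp only [psdPow, dif_pos hA.isHermitian]
  set U := (hA.isHermitian.eigenvectorUnitary : Matrix (Fin n) (Fin n) ℂ)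
  have hU : Uᴴ * U = 1 := Matrix.mem_unitaryGroup_iff'.mp hA.isHermitian.eigenvectorUnitary.2
  have h : ∀ D E : Matrix (Fin n) (Fin n) ℂ, U * D * Uᴴ * (U * E * Uᴴ) = U * (D * E) * Uᴴ := by
    intro D E
    calc U * D * Uᴴ * (U * E * Uᴴ) = U * D * (Uᴴ * U) * E * Uᴴ := by noncomm_ring
      _ = U * (D * E) * Uᴴ := by rw [hU, mul_one, mul_assoc U]
  rw [h, Matrix.diagonal_mul_diagonal]
  simp only [Real.rpow_add' (hA.eigenvalues_nonneg _) hst, Complex.ofReal_mul]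

theorem psdPow_one (hA : A.PosSemidef) : psdPow A 1 = A := by
  rw [psdPow, dif_pos hA.isHermitian]
  conv_rhs => rw [hA.isHermitian.spectral_theorem]
  simp [Unitary.conjStarAlgAut_apply, Matrix.star_eq_conjTranspose, Function.comp_def]

theorem psdPow_quarter_mul_self (hA : A.PosSemidef) :
    psdPow A (1 / 4) * psdPow A (1 / 4) = psdPow A (1 / 2) := by
  rw [psdPow_mul_psdPow hA (by norm_num)]
  norm_num

theorem psdPow_half_mul_self (hA : A.PosSemidef) :
    psdPow A (1 / 2) * psdPow A (1 / 2) = A := by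
  rw [psdPow_mul_psdPow hA (by norm_num), add_halves, psdPow_one hA]

end Power

end UnitarilyInvariant

open UnitarilyInvariant

theorem stmt2 {n : ℕ} (x y : Matrix (Fin n) (Fin n) ℂ)
    (hx : x.PosSemidef) (hy : y.PosSemidef)
    (N : Matrix (Fin n) (Fin n) ℂ → ℝ)
    (hN_add : ∀ A B, N (A + B) ≤ N A + N B)
    (hN_smul : ∀ (c : ℂ) A, N (c • A) = ‖c‖ * N A)
    (hN_zero : ∀ A, N A = 0 ↔ A = 0)
    (hN_unitary : ∀ (A U V : Matrix (Fin n) (Fin n) ℂ),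
      U ∈ Matrix.unitaryGroup (Fin n) ℂ → V ∈ Matrix.unitaryGroup (Fin n) ℂ →
      N (U * A * V) = N A)
    :
    N (psdPow y (1/4) * psdPow x (1/2) * psdPow y (1/4) +
        psdPow x (1/4) * psdPow y (1/2) * psdPow x (1/4)) ≤ N (x + y) := by
  have hN : IsUISeminorm N := ⟨hN_add, hN_smul, hN_unitary⟩
  have h1 := hN.mul_sq_mul_le (psdPow_posSemidef hx (1 / 4)) (psdPow_posSemidef hy (1 / 4))
  have h2 := hN.mul_sq_mul_le (psdPow_posSemidef hy (1 / 4)) (psdPow_posSemidef hx (1 / 4))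
  simp only [psdPow_quarter_mul_self hx, psdPow_quarter_mul_self hy, psdPow_half_mul_self hx,
    psdPow_half_mul_self hy] at h1 h2
  rw [add_comm y x] at h2
  exact (hN_add _ _).trans (by linarith)
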